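/- Explicit large s-harmonic functions on the unit ball: let B ⊂ ℝ^N be the open unit ball and let 0 < σ < 1−s. Define u_σ : ℝ^N → ℝ by u_σ(x) = c(N,s)/(1−|x|²)^σ for |x| < 1, u_σ(x) = c(N,s+σ)/(|x|²−1)^σ for |x| > 1, and u_σ(x) = 0 for |x| = 1. Then u_σ is s-harmonic in B. Moreover, the function u_{1−s} defined by u_{1−s}(x) = c(N,s)/(1−|x|²)^{1−s} for |x| < 1 and u_{1−s}(x) = 0 for |x| ≥ 1 is also s-harmonic in B. -/

import Mathlib

open MeasureTheory Filter

/-- The constant `c(N,s) = Γ(N/2)·sin(πs)/π^{1+N/2}`. -/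
noncomputable def cK (N : ℕ) (s : ℝ) : ℝ :=
  Real.Gamma ((N : ℝ) / 2) * Real.sin (Real.pi * s) / Real.pi ^ (1 + (N : ℝ) / 2)

/-- The kernel `η_r(x) = c(N,s)·r^{2s}/(|x|^N·(|x|²−r²)^s)` for `|x| > r`, and `0` for `|x| ≤ r`. -/
noncomputable def eta (N : ℕ) (s r : ℝ) (x : EuclideanSpace ℝ (Fin N)) : ℝ :=
  if r < ‖x‖ then cK N s * r ^ (2 * s) / (‖x‖ ^ N * (‖x‖ ^ 2 - r ^ 2) ^ s) else 0

/-- A function `u` is `s`-harmonic on an open set `Ω` if it is continuous on `Ω` and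
for any `x ∈ Ω` and any `0 < r < dist(x, ∂Ω)` the nonlocal mean value property
`u(x) = ∫_{ℝ^N∖B_r(x)} η_r(y−x)·u(y) dy` holds, the integral being absolutely convergent. -/
def IsSHarmonic (N : ℕ) (s : ℝ) (Ω : Set (EuclideanSpace ℝ (Fin N)))
    (u : EuclideanSpace ℝ (Fin N) → ℝ) : Prop :=
  ContinuousOn u Ω ∧
    ∀ x ∈ Ω, ∀ r : ℝ, 0 < r → ENNReal.ofReal r < EMetric.infEdist x Ωᶜ →
      IntegrableOn (fun y => eta N s r (y - x) * u y) (Metric.ball x r)ᶜ ∧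
      u x = ∫ y in (Metric.ball x r)ᶜ, eta N s r (y - x) * u y

/-- The explicit function `u_σ`, equal to `c(N,s)/(1−|x|²)^σ` inside the unit ball,
`c(N,s+σ)/(|x|²−1)^σ` outside the closed unit ball, and `0` on the unit sphere. -/
noncomputable def uSigma (N : ℕ) (s σ : ℝ) (x : EuclideanSpace ℝ (Fin N)) : ℝ :=
  if ‖x‖ < 1 then cK N s / (1 - ‖x‖ ^ 2) ^ σ
  else if 1 < ‖x‖ then cK N (s + σ) / (‖x‖ ^ 2 - 1) ^ σ
  else 0

/-- The limiting function `u_{1−s}`, equal to `c(N,s)/(1−|x|²)^{1−s}` inside the unit ball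
and `0` outside. -/
noncomputable def uLim (N : ℕ) (s : ℝ) (x : EuclideanSpace ℝ (Fin N)) : ℝ :=
  if ‖x‖ < 1 then cK N s / (1 - ‖x‖ ^ 2) ^ (1 - s) else 0

theorem norm_one_sub_le_two_mul {u : ℂ} (hu : ‖u‖ = 1) {ρ : ℝ} (h0 : 0 ≤ ρ) (h1 : ρ ≤ 1) :
    ‖1 - u‖ ≤ 2 * ‖1 - ρ * u‖ := by
  have h2 : ‖(ρ : ℂ) * u‖ = ρ := by simp [hu, abs_of_nonneg h0]
  have h3 : 1 - ρ ≤ ‖1 - ρ * u‖ := by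
    have := norm_sub_norm_le (1 : ℂ) (ρ * u)
    rwa [h2, norm_one] at this
  have h4 : ‖(ρ : ℂ) * u - u‖ = 1 - ρ := by
    rw [show (ρ : ℂ) * u - u = ((ρ - 1 : ℝ) : ℂ) * u by push_cast; ring, norm_mul, hu,
      Complex.norm_real, Real.norm_eq_abs, abs_of_nonpos (by linarith)]
    ring
  calc ‖1 - u‖ = ‖(1 - ρ * u) + (ρ * u - u)‖ := by ring_nf
    _ ≤ _ := norm_add_le _ _
    _ ≤ _ := by rw [h4]; linarith

theorem norm_one_sub_mul_cpow_le {u : ℂ} (hu : ‖u‖ = 1) (hu1 : u ≠ 1) {ρ : ℝ} (h0 : 0 ≤ ρ)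
    (h1 : ρ ≤ 1) (p : ℝ) :
    ‖(1 - ρ * u) ^ ((-p : ℝ) : ℂ)‖ ≤ 2 ^ |p| * ‖1 - u‖ ^ (-max p 0) := by
  have hpos : 0 < ‖1 - u‖ := norm_pos_iff.2 (sub_ne_zero.2 hu1.symm)
  have hle := norm_one_sub_le_two_mul hu h0 h1
  have hpos' : 0 < ‖1 - ρ * u‖ := by linarith
  rw [Complex.norm_cpow_real]
  rcases le_total 0 p with hp | hp
  · rw [abs_of_nonneg hp, max_eq_left hp]
    calc ‖1 - ρ * u‖ ^ (-p) ≤ (2⁻¹ * ‖1 - u‖) ^ (-p) :=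
          Real.rpow_le_rpow_of_nonpos (by positivity) (by linarith) (by linarith)
      _ = _ := by
          rw [Real.mul_rpow (by norm_num) hpos.le, Real.inv_rpow (by norm_num),
            ← Real.rpow_neg (by norm_num), neg_neg]
  · rw [abs_of_nonpos hp, max_eq_right hp, neg_zero, Real.rpow_zero, mul_one]
    refine Real.rpow_le_rpow hpos'.le ?_ (by linarith)
    calc ‖1 - ρ * u‖ ≤ ‖(1 : ℂ)‖ + ‖ρ * u‖ := norm_sub_le _ _
      _ ≤ 2 := by simp [hu, abs_of_nonneg h0]; linarith

theorem rpow_neg_mul_rpow_neg_le {x y d p q : ℝ} (hx : 0 < x) (hy : 0 < y) (hd : 0 < d)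
    (hxy : d ≤ x + y) (hp : 0 ≤ p) (hq : 0 ≤ q) :
    x ^ (-p) * y ^ (-q) ≤ ((d / 2) ^ (-p) + (d / 2) ^ (-q)) * (x ^ (-p) + y ^ (-q)) := by
  have hx' := Real.rpow_nonneg hx.le (-p)
  have hy' := Real.rpow_nonneg hy.le (-q)
  have hp' := Real.rpow_nonneg (half_pos hd).le (-p)
  have hq' := Real.rpow_nonneg (half_pos hd).le (-q)
  rcases le_total (d / 2) x with h | h
  · have := Real.rpow_le_rpow_of_nonpos (half_pos hd) h (neg_nonpos.2 hp)
    nlinarith [mul_le_mul_of_nonneg_right this hy', mul_nonneg hp' hx', mul_nonneg hq' hx',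
      mul_nonneg hq' hy']
  · have := Real.rpow_le_rpow_of_nonpos (half_pos hd) (show d / 2 ≤ y by linarith)
      (neg_nonpos.2 hq)
    nlinarith [mul_le_mul_of_nonneg_left this hx', mul_nonneg hp' hx', mul_nonneg hp' hy',
      mul_nonneg hq' hy']

theorem exists_prod_norm_sub_rpow_neg_le {ι : Type*} (e : ι → ℂ) (he : Function.Injective e)
    (q : ι → ℝ) (hq : ∀ i, 0 ≤ q i) (S : Finset ι) :
    ∃ K : ℝ, 0 ≤ K ∧ ∀ z : ℂ, (∀ i, z ≠ e i) →
      ∏ i ∈ S, ‖z - e i‖ ^ (-q i) ≤ K * (1 + ∑ i ∈ S, ‖z - e i‖ ^ (-q i)) := by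
  classical
  induction S using Finset.induction_on with
  | empty => exact ⟨1, zero_le_one, by simp⟩
  | insert a S ha ih =>
    obtain ⟨K, hK, h⟩ := ih
    set C : ι → ℝ := fun j =>
      (‖e a - e j‖ / 2) ^ (-q a) + (‖e a - e j‖ / 2) ^ (-q j) with hC
    have hC0 : ∀ j, 0 ≤ C j := fun j => by positivity
    refine ⟨K * (1 + ∑ j ∈ S, C j), mul_nonneg hK
      (add_nonneg zero_le_one (Finset.sum_nonneg fun j _ => hC0 j)), fun z hz => ?_⟩
    have hf : ∀ i, 0 ≤ ‖z - e i‖ ^ (-q i) := fun i => by positivity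
    set f : ι → ℝ := fun i => ‖z - e i‖ ^ (-q i)
    have hpair : ∀ j ∈ S, f a * f j ≤ C j * (f a + f j) := by
      intro j hj
      have haj : a ≠ j := fun h => ha (h ▸ hj)
      refine rpow_neg_mul_rpow_neg_le (norm_pos_iff.2 (sub_ne_zero.2 (hz a)))
        (norm_pos_iff.2 (sub_ne_zero.2 (hz j)))
        (norm_pos_iff.2 (sub_ne_zero.2 (he.ne haj))) ?_ (hq a) (hq j)
      calc ‖e a - e j‖ = ‖(z - e j) - (z - e a)‖ := by ring_nf
        _ ≤ _ := norm_sub_le _ _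
        _ = _ := add_comm _ _
    rw [Finset.prod_insert ha, Finset.sum_insert ha]
    calc f a * ∏ i ∈ S, f i ≤ f a * (K * (1 + ∑ i ∈ S, f i)) :=
          mul_le_mul_of_nonneg_left (h z hz) (hf a)
      _ = K * (f a + ∑ i ∈ S, f a * f i) := by rw [← Finset.mul_sum]; ring
      _ ≤ K * (f a + ∑ i ∈ S, C i * (f a + ∑ j ∈ S, f j)) := by
          refine mul_le_mul_of_nonneg_left (add_le_add le_rfl (Finset.sum_le_sum fun i hi =>
            (hpair i hi).trans (mul_le_mul_of_nonneg_left (add_le_add le_rfl ?_) (hC0 i)))) hK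
          exact Finset.single_le_sum (f := f) (fun j _ => hf j) hi
      _ = K * (f a + (∑ i ∈ S, C i) * (f a + ∑ j ∈ S, f j)) := by rw [← Finset.sum_mul]
      _ ≤ K * (1 + ∑ i ∈ S, C i) * (1 + (f a + ∑ i ∈ S, f i)) := by
          have h1 := Finset.sum_nonneg (s := S) fun j _ => hC0 j
          have h2 := Finset.sum_nonneg (s := S) (f := f) fun j _ => hf j
          rw [mul_assoc]
          gcongr
          nlinarith

theorem intervalIntegrable_norm_one_sub_exp_rpow (α : ℝ) {q : ℝ} (h0 : 0 ≤ q) (h1 : q < 1)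
    (a b : ℝ) :
    IntervalIntegrable (fun θ : ℝ => ‖1 - Complex.exp (((θ + α : ℝ) : ℂ) * Complex.I)‖ ^ (-q))
      volume a b := by
  have key : IntervalIntegrable
      (fun θ : ℝ => ‖1 - Complex.exp ((θ : ℂ) * Complex.I)‖ ^ (-q)) volume
      (-Real.pi) (-Real.pi + 2 * Real.pi) := by
    have hpos : IntervalIntegrable (fun x : ℝ => |x| ^ (-q)) volume 0 Real.pi := by
      refine (intervalIntegral.intervalIntegrable_rpow' (by linarith : -1 < -q)).congr_uIoo ?_
      intro x hx
      rw [Set.uIoo_of_le Real.pi_pos.le] at hx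
      simp [abs_of_pos hx.1]
    have hneg : IntervalIntegrable (fun x : ℝ => |x| ^ (-q)) volume (-Real.pi) 0 := by
      have := (IntervalIntegrable.iff_comp_neg).1 hpos
      simpa using this.symm
    refine ((hneg.trans hpos).const_mul ((2 / Real.pi) ^ (-q))).mono_fun' ?_ ?_ |> fun h => by
      convert h using 1; ring
    · exact Measurable.aestronglyMeasurable (by fun_prop)
    · rw [Set.uIoc_of_le (by linarith [Real.pi_pos])]
      have h0' : ∀ᵐ x : ℝ ∂(volume.restrict (Set.Ioc (-Real.pi) Real.pi)), x ≠ 0 :=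
        ae_restrict_of_ae (by simp [ae_iff])
      filter_upwards [ae_restrict_mem measurableSet_Ioc, h0'] with x hx hx0
      rw [Real.norm_of_nonneg (by positivity), norm_sub_rev, mul_comm (x : ℂ),
        Complex.norm_exp_I_mul_ofReal_sub_one, ← Real.mul_rpow (by positivity) (abs_nonneg _)]
      have hx2 : |x / 2| ≤ Real.pi / 2 := by
        rw [abs_div, abs_two]; gcongr; exact abs_le.2 ⟨hx.1.le, hx.2⟩
      have := Real.mul_abs_le_abs_sin hx2
      rw [abs_div, abs_two] at this
      refine Real.rpow_le_rpow_of_nonpos (by positivity) ?_ (by linarith)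
      rw [norm_mul, Real.norm_eq_abs, Real.norm_eq_abs, abs_two]
      linarith
  have hper : Function.Periodic
      (fun θ : ℝ => ‖1 - Complex.exp ((θ : ℂ) * Complex.I)‖ ^ (-q)) (2 * Real.pi) := by
    intro θ
    simp only
    rw [show (((θ + 2 * Real.pi : ℝ) : ℂ) * Complex.I) =
      (θ : ℂ) * Complex.I + 2 * Real.pi * Complex.I by push_cast; ring,
      Complex.exp_add, Complex.exp_two_pi_mul_I, mul_one]
  have := (hper.intervalIntegrable Real.two_pi_pos.ne' key (a + α) (b + α)).comp_add_right α
  simpa using this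

/-- The boundary value at angle `x` of the function `ζ ↦ (1 - ζ) ^ (-p)` on the unit disc. -/
noncomputable def circleFactor (p x : ℝ) : ℂ :=
  (1 - Complex.exp ((x : ℂ) * Complex.I)) ^ ((-p : ℝ) : ℂ)

theorem measurable_circleFactor (p : ℝ) : Measurable (circleFactor p) := by
  unfold circleFactor
  fun_prop

theorem re_one_sub_pos {u : ℂ} (hu : ‖u‖ ≤ 1) (hu1 : u ≠ 1) : 0 < (1 - u).re := by
  have h1 : u.re ≤ 1 := (Complex.re_le_norm u).trans hu
  rcases h1.lt_or_eq with h | h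
  · simpa using h
  · exfalso
    apply hu1
    have h2 := Complex.sq_norm u
    rw [Complex.normSq_apply, h] at h2
    have h3 : u.im = 0 := by
      have : u.im * u.im ≤ 0 := by nlinarith [norm_nonneg u]
      exact mul_self_eq_zero.1 (le_antisymm this (mul_self_nonneg _))
    exact Complex.ext (by simpa using h) (by simpa using h3)

theorem ae_exp_add_mul_I_ne_one (α : ℝ) :
    ∀ᵐ θ : ℝ, Complex.exp (((θ + α : ℝ) : ℂ) * Complex.I) ≠ 1 := by
  have : (Set.range fun n : ℤ => n * (2 * Real.pi) - α).Countable := Set.countable_range _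
  filter_upwards [this.ae_notMem volume] with θ hθ h
  obtain ⟨n, hn⟩ := Complex.exp_eq_one_iff.1 h
  apply hθ
  refine ⟨n, ?_⟩
  have h2 : (((θ + α : ℝ) : ℂ)) = ((n * (2 * Real.pi) : ℝ) : ℂ) := by
    apply mul_right_cancel₀ Complex.I_ne_zero
    rw [hn]; push_cast; ring
  have h3 := Complex.ofReal_injective h2
  simp only
  linarith

/-- The mean value property on the unit circle for a product of powers
`(1 - exp (α i * I) * ζ) ^ (-p i)` with integrable boundary singularities. -/
theorem integral_prod_circleFactor {ι : Type*} [Fintype ι] (α p : ι → ℝ)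
    (hα : Function.Injective fun i => Complex.exp (((-α i : ℝ) : ℂ) * Complex.I))
    (hp : ∀ i, p i < 1) :
    IntervalIntegrable (fun θ : ℝ => ∏ i, circleFactor (p i) (θ + α i)) volume 0 (2 * Real.pi) ∧
    ∫ θ in (0 : ℝ)..2 * Real.pi, ∏ i, circleFactor (p i) (θ + α i) = 2 * Real.pi := by
  set u : ι → ℝ → ℂ := fun i θ => Complex.exp (((θ + α i : ℝ) : ℂ) * Complex.I) with hu
  have hnu : ∀ i θ, ‖u i θ‖ = 1 := fun i θ => Complex.norm_exp_ofReal_mul_I _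
  have hae : ∀ᵐ θ : ℝ, ∀ i, u i θ ≠ 1 := ae_all_iff.2 fun i => ae_exp_add_mul_I_ne_one (α i)
  set q : ι → ℝ := fun i => max (p i) 0 with hq
  have hq0 : ∀ i, 0 ≤ q i := fun i => le_max_right _ _
  have hq1 : ∀ i, q i < 1 := fun i => max_lt (hp i) zero_lt_one
  obtain ⟨K, hK, hKle⟩ := exists_prod_norm_sub_rpow_neg_le _ hα q hq0 Finset.univ
  have hrot : ∀ i (θ : ℝ), ‖Complex.exp ((θ : ℂ) * Complex.I) -
      Complex.exp (((-α i : ℝ) : ℂ) * Complex.I)‖ = ‖1 - u i θ‖ := by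
    intro i θ
    have : 1 - u i θ = -(Complex.exp ((α i : ℂ) * Complex.I) *
        (Complex.exp ((θ : ℂ) * Complex.I) -
          Complex.exp (((-α i : ℝ) : ℂ) * Complex.I))) := by
      simp only [hu]
      rw [mul_sub, ← Complex.exp_add, ← Complex.exp_add]
      have h1 : (α i : ℂ) * Complex.I + ((-α i : ℝ) : ℂ) * Complex.I = 0 := by push_cast; ring
      have h2 : (α i : ℂ) * Complex.I + (θ : ℂ) * Complex.I =
        ((θ + α i : ℝ) : ℂ) * Complex.I := by push_cast; ring
      rw [h1, h2, Complex.exp_zero]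
      ring
    rw [this, norm_neg, norm_mul, Complex.norm_exp_ofReal_mul_I, one_mul]
  set bound : ℝ → ℝ := fun θ =>
    (∏ i, 2 ^ |p i|) * (K * (1 + ∑ i, ‖1 - u i θ‖ ^ (-q i))) with hbound
  have hbi : IntervalIntegrable bound volume 0 (2 * Real.pi) := by
    refine IntervalIntegrable.const_mul (IntervalIntegrable.const_mul
      (IntervalIntegrable.add intervalIntegrable_const ?_) _) _
    have := IntervalIntegrable.sum (Finset.univ : Finset ι)
      (f := fun i θ => ‖1 - u i θ‖ ^ (-q i)) (μ := volume) (a := 0) (b := 2 * Real.pi)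
      fun i _ => intervalIntegrable_norm_one_sub_exp_rpow (α i) (hq0 i) (hq1 i) _ _
    have hs : (fun θ => ∑ i, ‖1 - u i θ‖ ^ (-q i)) =
        ∑ i, fun θ => ‖1 - u i θ‖ ^ (-q i) := by
      ext θ
      simp
    rwa [hs]
  have hle : ∀ (ρ : ℝ), 0 ≤ ρ → ρ ≤ 1 → ∀ θ, (∀ i, u i θ ≠ 1) →
      ‖∏ i, (1 - ρ * u i θ) ^ ((-p i : ℝ) : ℂ)‖ ≤ bound θ := by
    intro ρ h0 h1 θ hθ
    rw [norm_prod]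
    calc ∏ i, ‖(1 - ρ * u i θ) ^ ((-p i : ℝ) : ℂ)‖
        ≤ ∏ i, (2 ^ |p i| * ‖1 - u i θ‖ ^ (-q i)) :=
          Finset.prod_le_prod (fun _ _ => norm_nonneg _) fun i _ =>
            norm_one_sub_mul_cpow_le (hnu i θ) (hθ i) h0 h1 (p i)
      _ = (∏ i, 2 ^ |p i|) * ∏ i, ‖1 - u i θ‖ ^ (-q i) := Finset.prod_mul_distrib
      _ ≤ bound θ := by
          refine mul_le_mul_of_nonneg_left ?_ (Finset.prod_nonneg fun i _ => by positivity)
          have := hKle (Complex.exp ((θ : ℂ) * Complex.I)) fun i h => hθ i (by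
            have h2 := hrot i θ
            rw [sub_eq_zero.2 h, norm_zero] at h2
            exact (sub_eq_zero.1 (norm_eq_zero.1 h2.symm)).symm)
          simpa only [hrot] using this
  have hmeas : Measurable fun θ : ℝ => ∏ i, circleFactor (p i) (θ + α i) :=
    Finset.measurable_prod _ fun i _ => (measurable_circleFactor (p i)).comp (by fun_prop)
  have hlim : ∀ θ, (∀ i, u i θ ≠ 1) →
      Tendsto (fun ρ : ℝ => ∏ i, (1 - ρ * u i θ) ^ ((-p i : ℝ) : ℂ)) (nhdsWithin 1 (Set.Iio 1))
        (nhds (∏ i, circleFactor (p i) (θ + α i))) := by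
    intro θ hθ
    refine tendsto_finsetProd _ fun i _ => ?_
    have hc : ContinuousAt (fun ρ : ℝ => (1 - ρ * u i θ) ^ ((-p i : ℝ) : ℂ)) 1 := by
      refine ContinuousAt.cpow (by fun_prop) continuousAt_const ?_
      left
      simpa using re_one_sub_pos (hnu i θ).le (hθ i)
    have := hc.tendsto.mono_left (nhdsWithin_le_nhds (s := Set.Iio 1))
    simpa [circleFactor, hu] using this
  have hint : ∀ ρ : ℝ, 0 ≤ ρ → ρ < 1 →
      ∫ θ in (0 : ℝ)..2 * Real.pi, ∏ i, (1 - ρ * u i θ) ^ ((-p i : ℝ) : ℂ) = 2 * Real.pi := by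
    intro ρ h0 h1
    have hd : DiffContOnCl ℂ
        (fun z : ℂ => ∏ i, (1 - Complex.exp ((α i : ℂ) * Complex.I) * z) ^ ((-p i : ℝ) : ℂ))
        (Metric.ball 0 |ρ|) := by
      apply DifferentiableOn.diffContOnCl
      refine DifferentiableOn.mono (t := Metric.ball 0 1) ?_ ?_
      · refine DifferentiableOn.fun_finsetProd fun i _ => ?_
        refine DifferentiableOn.cpow (by fun_prop) (by fun_prop) fun z hz => ?_
        left
        rw [mem_ball_zero_iff] at hz
        have hn : ‖Complex.exp ((α i : ℂ) * Complex.I) * z‖ < 1 := by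
          rwa [norm_mul, Complex.norm_exp_ofReal_mul_I, one_mul]
        refine re_one_sub_pos hn.le fun h => ?_
        rw [h, norm_one] at hn
        exact lt_irrefl _ hn
      · refine (Metric.closure_ball_subset_closedBall).trans ?_
        exact Metric.closedBall_subset_ball (by rwa [abs_of_nonneg h0])
    have h := hd.circleAverage
    rw [Real.circleAverage_def] at h
    simp only [mul_zero, sub_zero, Complex.one_cpow, Finset.prod_const_one] at h
    have h2 : ∀ θ : ℝ, ∏ i, (1 - Complex.exp ((α i : ℂ) * Complex.I) * circleMap 0 ρ θ) ^
        ((-p i : ℝ) : ℂ) = ∏ i, (1 - ρ * u i θ) ^ ((-p i : ℝ) : ℂ) := by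
      intro θ
      refine Finset.prod_congr rfl fun i _ => ?_
      have : Complex.exp ((α i : ℂ) * Complex.I) * circleMap 0 ρ θ = ρ * u i θ := by
        simp only [hu, circleMap, zero_add]
        rw [Complex.ofReal_add, add_mul, Complex.exp_add]
        ring
      rw [this]
    simp only [h2] at h
    rw [inv_smul_eq_iff₀ Real.two_pi_pos.ne'] at h
    rw [h]
    simp
  constructor
  · refine hbi.mono_fun' hmeas.aestronglyMeasurable (ae_restrict_of_ae ?_)
    filter_upwards [hae] with θ hθ
    simpa [circleFactor, hu] using hle 1 zero_le_one le_rfl θ hθ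
  · have hev : ∀ᶠ ρ : ℝ in nhdsWithin 1 (Set.Iio 1), 0 ≤ ρ ∧ ρ < 1 := by
      filter_upwards [Ioo_mem_nhdsLT (show (0 : ℝ) < 1 by norm_num)] with ρ hρ
      exact ⟨hρ.1.le, hρ.2⟩
    have hT := intervalIntegral.tendsto_integral_filter_of_dominated_convergence
      (μ := volume) (a := 0) (b := 2 * Real.pi) (l := nhdsWithin 1 (Set.Iio (1 : ℝ)))
      (F := fun ρ θ => ∏ i, (1 - ρ * u i θ) ^ ((-p i : ℝ) : ℂ))
      (f := fun θ => ∏ i, circleFactor (p i) (θ + α i)) bound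
      (Eventually.of_forall fun ρ => (Finset.measurable_prod _ fun i _ => by
        simp only [hu]; fun_prop).aestronglyMeasurable)
      (hev.mono fun ρ hρ => hae.mono fun θ hθ _ => hle ρ hρ.1 hρ.2.le θ hθ) hbi
      (hae.mono fun θ hθ _ => hlim θ hθ)
    refine tendsto_nhds_unique hT ?_
    refine tendsto_const_nhds.congr' ?_
    filter_upwards [hev] with ρ hρ
    exact (hint ρ hρ.1 hρ.2).symm

theorem circleFactor_add_two_pi (p x : ℝ) :
    circleFactor p (x + 2 * Real.pi) = circleFactor p x := by
  unfold circleFactor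
  rw [show (((x + 2 * Real.pi : ℝ) : ℂ) * Complex.I) =
      (x : ℂ) * Complex.I + 2 * Real.pi * Complex.I by push_cast; ring,
      Complex.exp_add, Complex.exp_two_pi_mul_I, mul_one]

theorem circleFactor_of_mem_Ioo (p : ℝ) {x : ℝ} (hx : x ∈ Set.Ioo 0 (2 * Real.pi)) :
    circleFactor p x = (((2 * Real.sin (x / 2)) ^ (-p) : ℝ) : ℂ) *
      Complex.exp (((-p * ((x - Real.pi) / 2) : ℝ) : ℂ) * Complex.I) := by
  have hsin : 0 < 2 * Real.sin (x / 2) :=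
    mul_pos two_pos (Real.sin_pos_of_pos_of_lt_pi (by linarith [hx.1]) (by linarith [hx.2]))
  have h1 : 1 - Complex.exp ((x : ℂ) * Complex.I) = ((2 * Real.sin (x / 2) : ℝ) : ℂ) *
      Complex.exp ((((x - Real.pi) / 2 : ℝ) : ℂ) * Complex.I) := by
    rw [Complex.exp_mul_I, Complex.exp_mul_I, ← Complex.ofReal_cos, ← Complex.ofReal_sin,
      ← Complex.ofReal_cos, ← Complex.ofReal_sin,
      show (x - Real.pi) / 2 = x / 2 - Real.pi / 2 by ring, Real.cos_sub_pi_div_two,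
      Real.sin_sub_pi_div_two]
    have hc : Real.cos x = 1 - 2 * Real.sin (x / 2) ^ 2 := by
      have := Real.cos_two_mul (x / 2)
      rw [Real.cos_sq', mul_div_cancel₀ x two_ne_zero] at this
      linarith
    have hs : Real.sin x = 2 * Real.sin (x / 2) * Real.cos (x / 2) := by
      have := Real.sin_two_mul (x / 2)
      rwa [mul_div_cancel₀ x two_ne_zero] at this
    rw [hc, hs]
    push_cast
    ring
  have hlog : Complex.log (Complex.exp ((((x - Real.pi) / 2 : ℝ) : ℂ) * Complex.I)) =
      (((x - Real.pi) / 2 : ℝ) : ℂ) * Complex.I := by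
    apply Complex.log_exp
    · rw [Complex.im_ofReal_mul, Complex.I_im, mul_one]
      linarith [hx.1, Real.pi_pos]
    · rw [Complex.im_ofReal_mul, Complex.I_im, mul_one]
      linarith [hx.2, Real.pi_pos]
  unfold circleFactor
  rw [h1, Complex.cpow_def_of_ne_zero (mul_ne_zero (by exact_mod_cast hsin.ne')
    (Complex.exp_ne_zero _)), Complex.log_ofReal_mul hsin (Complex.exp_ne_zero _), hlog, add_mul,
    Complex.exp_add, Real.rpow_def_of_pos hsin]
  push_cast
  ring_nf

theorem circleFactor_neg (p x : ℝ) :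
    circleFactor p (-x) = (starRingEnd ℂ) (circleFactor p x) := by
  unfold circleFactor
  have h : ((-x : ℝ) : ℂ) * Complex.I = (starRingEnd ℂ) ((x : ℂ) * Complex.I) := by simp
  rw [h, Complex.exp_conj, ← map_one (starRingEnd ℂ), ← map_sub, map_one]
  rw [Complex.conj_cpow]
  · simp
  · intro harg
    have := Complex.arg_eq_pi_iff.1 harg
    have h2 := Complex.re_le_norm (Complex.exp ((x : ℂ) * Complex.I))
    rw [Complex.norm_exp_ofReal_mul_I] at h2
    rw [Complex.sub_re, Complex.one_re] at this
    linarith [this.1]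

theorem circleFactor_mul_circleFactor_add_pi (p : ℝ) {θ : ℝ} (hθ : θ ∈ Set.Ioo 0 Real.pi) :
    circleFactor p θ * circleFactor p (θ + Real.pi) = (((2 * Real.sin θ) ^ (-p) : ℝ) : ℂ) *
      Complex.exp (((-p * (θ - Real.pi / 2) : ℝ) : ℂ) * Complex.I) := by
  have h1 : 0 < Real.sin (θ / 2) :=
    Real.sin_pos_of_pos_of_lt_pi (by linarith [hθ.1]) (by linarith [hθ.1, hθ.2])
  have h2 : 0 < Real.sin ((θ + Real.pi) / 2) :=
    Real.sin_pos_of_pos_of_lt_pi (by linarith [hθ.1, Real.pi_pos]) (by linarith [hθ.2])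
  rw [circleFactor_of_mem_Ioo p ⟨hθ.1, by linarith [hθ.2, Real.pi_pos]⟩,
    circleFactor_of_mem_Ioo p ⟨by linarith [hθ.1, Real.pi_pos], by linarith [hθ.2]⟩,
    mul_mul_mul_comm, ← Complex.exp_add, ← Complex.ofReal_mul,
    ← Real.mul_rpow (by positivity) (by positivity)]
  congr 3
  · have h3 : Real.sin θ = 2 * Real.sin (θ / 2) * Real.cos (θ / 2) := by
      have := Real.sin_two_mul (θ / 2)
      rwa [mul_div_cancel₀ θ two_ne_zero] at this
    rw [show (θ + Real.pi) / 2 = θ / 2 + Real.pi / 2 by ring, Real.sin_add_pi_div_two, h3]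
    ring
  · push_cast
    ring

theorem circleFactor_add_mul_circleFactor_sub (p : ℝ) {θ α : ℝ} (hθ : θ ∈ Set.Ioo 0 Real.pi)
    (hα : α ∈ Set.Ioo 0 Real.pi) (hne : θ ≠ α) :
    circleFactor p (θ + α) * circleFactor p (θ - α) =
      (((2 * |Real.cos θ - Real.cos α|) ^ (-p) : ℝ) : ℂ) *
      Complex.exp (((-p * (θ - if θ < α then 0 else Real.pi) : ℝ) : ℂ) * Complex.I) := by
  have h1 : 0 < Real.sin ((θ + α) / 2) := Real.sin_pos_of_pos_of_lt_pi
    (by linarith [hθ.1, hα.1]) (by linarith [hθ.2, hα.2])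
  have hcos := Real.cos_sub_cos θ α
  rcases hne.lt_or_gt with h | h
  · have h2 : 0 < Real.sin ((α - θ) / 2) := Real.sin_pos_of_pos_of_lt_pi
      (by linarith) (by linarith [hθ.1, hα.2])
    have h3 : Real.cos θ - Real.cos α =
        2 * Real.sin ((θ + α) / 2) * Real.sin ((α - θ) / 2) := by
      rw [hcos, show (θ - α) / 2 = -((α - θ) / 2) by ring, Real.sin_neg]
      ring
    rw [show θ - α = -(α - θ) by ring, circleFactor_neg,
      circleFactor_of_mem_Ioo p (x := α - θ) ⟨by linarith, by linarith [hθ.1, hα.2]⟩,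
      circleFactor_of_mem_Ioo p ⟨by linarith [hθ.1, hα.1], by linarith [hθ.2, hα.2]⟩,
      map_mul, Complex.conj_ofReal, ← Complex.exp_conj, map_mul, Complex.conj_ofReal,
      Complex.conj_I, mul_mul_mul_comm, ← Complex.exp_add, ← Complex.ofReal_mul,
      ← Real.mul_rpow (by positivity) (by positivity), h3, abs_of_pos (by positivity), if_pos h]
    congr 3
    · ring
    · push_cast
      ring
  · have h2 : 0 < Real.sin ((θ - α) / 2) := Real.sin_pos_of_pos_of_lt_pi
      (by linarith) (by linarith [hα.1, hθ.2])
    have h3 : Real.cos θ - Real.cos α =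
        -(2 * Real.sin ((θ + α) / 2) * Real.sin ((θ - α) / 2)) := by
      rw [hcos]
      ring
    rw [circleFactor_of_mem_Ioo p (x := θ - α) ⟨by linarith, by linarith [hα.1, hθ.2]⟩,
      circleFactor_of_mem_Ioo p ⟨by linarith [hθ.1, hα.1], by linarith [hθ.2, hα.2]⟩,
      mul_mul_mul_comm, ← Complex.exp_add, ← Complex.ofReal_mul,
      ← Real.mul_rpow (by positivity) (by positivity), h3, abs_neg, abs_of_pos (by positivity),
      if_neg h.not_gt]
    congr 3
    · ring
    · push_cast
      ring

/-- The angular density of the one-dimensional mean value formula, in the variable `θ` with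
`t = r / cos θ`. -/
noncomputable def angularDensity (s σ κ l θ : ℝ) : ℝ :=
  Real.sin θ ^ (1 - 2 * s) * |Real.cos θ| ^ (2 * s + 2 * σ - 1) * |Real.cos θ - κ| ^ (-σ) *
    |Real.cos θ - l| ^ (-σ) *
    if l < Real.cos θ ∧ Real.cos θ < κ then Real.sin (Real.pi * (s + σ))
    else Real.sin (Real.pi * s)

/-- The product of boundary factors whose real part is `angularDensity`. -/
noncomputable def circleProduct (s σ α β θ : ℝ) : ℂ :=
  (circleFactor (2 * s - 1) θ * circleFactor (2 * s - 1) (θ + Real.pi)) *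
  (circleFactor (1 - 2 * s - 2 * σ) (θ + Real.pi / 2) *
    circleFactor (1 - 2 * s - 2 * σ) (θ - Real.pi / 2)) *
  (circleFactor σ (θ + α) * circleFactor σ (θ - α)) *
  (circleFactor σ (θ + β) * circleFactor σ (θ - β))

theorem circleProduct_two_pi_sub (s σ α β θ : ℝ) :
    circleProduct s σ α β (2 * Real.pi - θ) = (starRingEnd ℂ) (circleProduct s σ α β θ) := by
  have h : ∀ p a, circleFactor p (2 * Real.pi - θ + a) =
      (starRingEnd ℂ) (circleFactor p (θ - a)) := fun p a => by
    rw [← circleFactor_neg, ← circleFactor_add_two_pi p (-(θ - a))]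
    ring_nf
  have h' : ∀ p a, circleFactor p (2 * Real.pi - θ - a) =
      (starRingEnd ℂ) (circleFactor p (θ + a)) := fun p a => by
    rw [← circleFactor_neg, ← circleFactor_add_two_pi p (-(θ + a))]
    ring_nf
  have h0 : ∀ p, circleFactor p (2 * Real.pi - θ) = (starRingEnd ℂ) (circleFactor p θ) :=
    fun p => by simpa using h p 0
  have hpi : ∀ p, circleFactor p (θ - Real.pi) = circleFactor p (θ + Real.pi) := fun p => by
    rw [← circleFactor_add_two_pi p (θ - Real.pi)]
    ring_nf
  simp only [circleProduct, h, h', h0, hpi, map_mul]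
  ring

theorem re_circleProduct {s σ α β θ : ℝ} (hα : α ∈ Set.Ioo 0 (Real.pi / 2))
    (hβ : β ∈ Set.Ioo (Real.pi / 2) Real.pi) (hθ : θ ∈ Set.Ioo 0 Real.pi) (h1 : θ ≠ α)
    (h2 : θ ≠ β) (h3 : θ ≠ Real.pi / 2) :
    (circleProduct s σ α β θ).re = angularDensity s σ (Real.cos α) (Real.cos β) θ := by
  have hα' : α ∈ Set.Ioo 0 Real.pi := ⟨hα.1, by linarith [hα.2, hα.1]⟩
  have hβ' : β ∈ Set.Ioo 0 Real.pi := ⟨by linarith [hβ.1, Real.pi_pos], hβ.2⟩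
  have hh : Real.pi / 2 ∈ Set.Ioo 0 Real.pi :=
    ⟨by linarith [Real.pi_pos], by linarith [Real.pi_pos]⟩
  have hinj := Real.injOn_cos
  have mem : ∀ {x}, x ∈ Set.Ioo 0 Real.pi → x ∈ Set.Icc 0 Real.pi := fun h => ⟨h.1.le, h.2.le⟩
  have hs : 0 < Real.sin θ := Real.sin_pos_of_mem_Ioo hθ
  have hc : 0 < |Real.cos θ| := by
    have := hinj.ne (mem hθ) (mem hh) h3
    rw [Real.cos_pi_div_two] at this
    exact abs_pos.2 this
  have ha : 0 < |Real.cos θ - Real.cos α| :=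
    abs_pos.2 (sub_ne_zero.2 (hinj.ne (mem hθ) (mem hα') h1))
  have hb : 0 < |Real.cos θ - Real.cos β| :=
    abs_pos.2 (sub_ne_zero.2 (hinj.ne (mem hθ) (mem hβ') h2))
  have hlta : Real.cos θ < Real.cos α ↔ α < θ := Real.strictAntiOn_cos.lt_iff_gt (mem hθ) (mem hα')
  have hltb : Real.cos β < Real.cos θ ↔ θ < β := Real.strictAntiOn_cos.lt_iff_gt (mem hβ') (mem hθ)
  have hmod : (2 * Real.sin θ) ^ (-(2 * s - 1)) * (2 * |Real.cos θ|) ^ (-(1 - 2 * s - 2 * σ)) *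
      (2 * |Real.cos θ - Real.cos α|) ^ (-σ) * (2 * |Real.cos θ - Real.cos β|) ^ (-σ) =
      Real.sin θ ^ (1 - 2 * s) * |Real.cos θ| ^ (2 * s + 2 * σ - 1) *
        |Real.cos θ - Real.cos α| ^ (-σ) * |Real.cos θ - Real.cos β| ^ (-σ) := by
    rw [Real.mul_rpow two_pos.le hs.le, Real.mul_rpow two_pos.le hc.le,
      Real.mul_rpow two_pos.le ha.le, Real.mul_rpow two_pos.le hb.le,
      show -(2 * s - 1) = 1 - 2 * s by ring,
      show -(1 - 2 * s - 2 * σ) = 2 * s + 2 * σ - 1 by ring]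
    have : (2 : ℝ) ^ (1 - 2 * s) * 2 ^ (2 * s + 2 * σ - 1) * 2 ^ (-σ) * 2 ^ (-σ) = 1 := by
      rw [← Real.rpow_add two_pos, ← Real.rpow_add two_pos, ← Real.rpow_add two_pos]
      ring_nf
      simp
    linear_combination (Real.sin θ ^ (1 - 2 * s) * |Real.cos θ| ^ (2 * s + 2 * σ - 1) *
        |Real.cos θ - Real.cos α| ^ (-σ) * |Real.cos θ - Real.cos β| ^ (-σ)) * this
  have hprod : ∀ m₁ m₂ m₃ m₄ a₁ a₂ a₃ a₄ : ℝ,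
      (((m₁ : ℂ) * Complex.exp ((a₁ : ℂ) * Complex.I)) *
      ((m₂ : ℂ) * Complex.exp ((a₂ : ℂ) * Complex.I)) *
      ((m₃ : ℂ) * Complex.exp ((a₃ : ℂ) * Complex.I)) *
      ((m₄ : ℂ) * Complex.exp ((a₄ : ℂ) * Complex.I))).re =
      m₁ * m₂ * m₃ * m₄ * Real.cos (a₁ + a₂ + a₃ + a₄) := by
    intro m₁ m₂ m₃ m₄ a₁ a₂ a₃ a₄
    rw [← Complex.exp_ofReal_mul_I_re, ← Complex.re_ofReal_mul]
    congr 1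
    push_cast
    simp only [add_mul, Complex.exp_add]
    ring
  rw [circleProduct, circleFactor_mul_circleFactor_add_pi _ hθ,
    circleFactor_add_mul_circleFactor_sub _ hθ hh h3,
    circleFactor_add_mul_circleFactor_sub _ hθ hα' h1,
    circleFactor_add_mul_circleFactor_sub _ hθ hβ' h2, hprod, Real.cos_pi_div_two, sub_zero, hmod,
    angularDensity]
  congr 1
  rw [← Real.cos_pi_div_two_sub, ← Real.cos_pi_div_two_sub]
  have hcase : θ < α ∨ (α < θ ∧ θ < Real.pi / 2) ∨ (Real.pi / 2 < θ ∧ θ < β) ∨ β < θ := by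
    grind
  rcases hcase with h | ⟨h, h'⟩ | ⟨h, h'⟩ | h
  · rw [if_pos h, if_pos (by linarith [hα.2] : θ < Real.pi / 2),
      if_pos (by linarith [hα.2, hβ.1] : θ < β), if_neg (by rw [hlta]; intro h4; linarith [h4.2])]
    rw [← Real.cos_neg]
    congr 1
    ring
  · rw [if_neg h.not_gt, if_pos h', if_pos (by linarith [hβ.1] : θ < β),
      if_pos (by rw [hlta, hltb]; exact ⟨by linarith [hβ.1], h⟩), ← Real.cos_neg]
    congr 1
    ring
  · rw [if_neg (by linarith [hα.2] : ¬ θ < α), if_neg h.not_gt, if_pos h',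
      if_pos (by rw [hlta, hltb]; exact ⟨h', by linarith [hα.2]⟩)]
    congr 1
    ring
  · rw [if_neg (by linarith [hα.2, hβ.1] : ¬ θ < α),
      if_neg (by linarith [hβ.1] : ¬ θ < Real.pi / 2),
      if_neg h.not_gt, if_neg (by rw [hltb]; intro h4; linarith [h4.1])]
    congr 1
    ring

theorem injective_exp_neg_mul_I {ι : Type*} {a : ι → ℝ} (ha : Function.Injective a)
    (hmem : ∀ i, a i ∈ Set.Ioc (-Real.pi) Real.pi) :
    Function.Injective fun i => Complex.exp (((-a i : ℝ) : ℂ) * Complex.I) := by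
  intro i j hij
  apply ha
  have hinv : ∀ k, Complex.exp ((a k : ℂ) * Complex.I) =
      (Complex.exp (((-a k : ℝ) : ℂ) * Complex.I))⁻¹ := fun k => by
    rw [← Complex.exp_neg]
    congr 1
    push_cast
    ring
  have h : Complex.exp ((a i : ℂ) * Complex.I) = Complex.exp ((a j : ℂ) * Complex.I) := by
    rw [hinv, hinv]
    exact congrArg _ hij
  have h2 : (a i : ℂ) * Complex.I = (a j : ℂ) * Complex.I := by
    apply Complex.exp_inj_of_neg_pi_lt_of_le_pi _ _ _ _ h
    all_goals rw [Complex.im_ofReal_mul, Complex.I_im, mul_one]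
    exacts [(hmem i).1, (hmem i).2, (hmem j).1, (hmem j).2]
  exact Complex.ofReal_injective (mul_right_cancel₀ Complex.I_ne_zero h2)

theorem integral_circleProduct {s σ α β : ℝ} (hs : s ∈ Set.Ioo (0 : ℝ) 1) (hσ : 0 < σ)
    (hσ' : σ ≤ 1 - s) (hα : α ∈ Set.Ioo 0 (Real.pi / 2))
    (hβ : β ∈ Set.Ioo (Real.pi / 2) Real.pi) :
    IntervalIntegrable (circleProduct s σ α β) volume 0 (2 * Real.pi) ∧
    ∫ θ in (0 : ℝ)..2 * Real.pi, circleProduct s σ α β θ = 2 * Real.pi := by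
  set a : Fin 8 → ℝ := ![-β, -(Real.pi / 2), -α, 0, α, Real.pi / 2, β, Real.pi] with ha
  set p : Fin 8 → ℝ := ![σ, 1 - 2 * s - 2 * σ, σ, 2 * s - 1, σ, 1 - 2 * s - 2 * σ, σ, 2 * s - 1]
    with hp
  have hπ := Real.pi_pos
  have hmono : StrictMono a := by
    rw [Fin.strictMono_iff_lt_succ]
    intro i
    fin_cases i <;> simp [ha] <;> linarith [hα.1, hα.2, hβ.1, hβ.2]
  have hmem : ∀ i, a i ∈ Set.Ioc (-Real.pi) Real.pi := by
    intro i
    fin_cases i <;> refine ⟨?_, ?_⟩ <;> simp [ha] <;> linarith [hα.1, hα.2, hβ.1, hβ.2]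
  have hlt : ∀ i, p i < 1 := by
    intro i
    fin_cases i <;> simp [hp] <;> linarith [hs.1, hs.2]
  have key := integral_prod_circleFactor a p (injective_exp_neg_mul_I hmono.injective hmem) hlt
  have heq : (fun θ : ℝ => ∏ i, circleFactor (p i) (θ + a i)) = circleProduct s σ α β := by
    ext θ
    rw [Fin.prod_univ_eight]
    simp [ha, hp, circleProduct, ← sub_eq_add_neg]
    ring
  simp only [funext_iff] at heq
  simpa only [heq] using key

theorem measurable_angularDensity (s σ κ l : ℝ) : Measurable (angularDensity s σ κ l) := by
  unfold angularDensity
  refine Measurable.mul (by fun_prop) (Measurable.ite ?_ measurable_const measurable_const)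
  exact (measurableSet_lt measurable_const Real.measurable_cos).inter
    (measurableSet_lt Real.measurable_cos measurable_const)

theorem angularDensity_nonneg {s σ : ℝ} (hs : s ∈ Set.Ioo (0 : ℝ) 1) (hσ : 0 < σ)
    (hσ' : σ ≤ 1 - s) (κ l : ℝ) {θ : ℝ} (hθ : θ ∈ Set.Ioo 0 Real.pi) :
    0 ≤ angularDensity s σ κ l θ := by
  have h0 := Real.sin_pos_of_mem_Ioo hθ
  have hπ := Real.pi_pos
  have h1 : 0 ≤ Real.sin (Real.pi * (s + σ)) :=
    Real.sin_nonneg_of_nonneg_of_le_pi (by have := hs.1; positivity) (by nlinarith)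
  have h2 : 0 ≤ Real.sin (Real.pi * s) :=
    Real.sin_nonneg_of_nonneg_of_le_pi (by have := hs.1; positivity) (by nlinarith [hs.2])
  unfold angularDensity
  split_ifs <;> positivity

/-- The one-dimensional mean value formula, written in the angular variable. -/
theorem lintegral_angularDensity {s σ κ l : ℝ} (hs : s ∈ Set.Ioo (0 : ℝ) 1) (hσ : 0 < σ)
    (hσ' : σ ≤ 1 - s) (hκ : κ ∈ Set.Ioo (0 : ℝ) 1) (hl : l ∈ Set.Ioo (-1 : ℝ) 0) :
    ∫⁻ θ in Set.Ioo 0 Real.pi, ENNReal.ofReal (angularDensity s σ κ l θ) =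
      ENNReal.ofReal Real.pi := by
  have hπ := Real.pi_pos
  have hα : Real.arccos κ ∈ Set.Ioo 0 (Real.pi / 2) :=
    ⟨Real.arccos_pos.2 hκ.2, Real.arccos_lt_pi_div_two.2 hκ.1⟩
  have hβ : Real.arccos l ∈ Set.Ioo (Real.pi / 2) Real.pi := by
    have h1 : 0 < Real.arccos (-l) := Real.arccos_pos.2 (by linarith [hl.1])
    have h2 : Real.arccos (-l) < Real.pi / 2 := Real.arccos_lt_pi_div_two.2 (by linarith [hl.2])
    rw [Real.arccos_neg] at h1 h2
    exact ⟨by linarith, by linarith⟩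
  have hcα : Real.cos (Real.arccos κ) = κ := Real.cos_arccos (by linarith [hκ.1]) hκ.2.le
  have hcβ : Real.cos (Real.arccos l) = l := Real.cos_arccos hl.1.le (by linarith [hl.2])
  obtain ⟨hi, hint⟩ := integral_circleProduct hs hσ hσ' hα hβ
  set Φ := circleProduct s σ (Real.arccos κ) (Real.arccos l) with hΦ
  have hre : IntervalIntegrable (fun θ => (Φ θ).re) volume 0 (2 * Real.pi) := ⟨hi.1.re, hi.2.re⟩
  have hreint : ∫ θ in (0 : ℝ)..2 * Real.pi, (Φ θ).re = 2 * Real.pi := by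
    have := intervalIntegral.intervalIntegral_re hi
    rw [hint] at this
    simpa using this
  have h1 : IntervalIntegrable (fun θ => (Φ θ).re) volume 0 Real.pi :=
    hre.mono_set (by
      rw [Set.uIcc_of_le hπ.le, Set.uIcc_of_le (by linarith)]
      exact Set.Icc_subset_Icc le_rfl (by linarith))
  have h2 : IntervalIntegrable (fun θ => (Φ θ).re) volume Real.pi (2 * Real.pi) :=
    hre.mono_set (by
      rw [Set.uIcc_of_le (by linarith), Set.uIcc_of_le (by linarith)]
      exact Set.Icc_subset_Icc hπ.le le_rfl)
  have h3 : ∫ θ in Real.pi..2 * Real.pi, (Φ θ).re = ∫ θ in (0 : ℝ)..Real.pi, (Φ θ).re := by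
    have := intervalIntegral.integral_comp_sub_left (a := 0) (b := Real.pi)
      (fun θ => (Φ θ).re) (2 * Real.pi)
    rw [sub_zero, show 2 * Real.pi - Real.pi = Real.pi by ring] at this
    rw [← this]
    simp only [hΦ, circleProduct_two_pi_sub, Complex.conj_re]
  have h4 : ∫ θ in (0 : ℝ)..Real.pi, (Φ θ).re = Real.pi := by
    have := intervalIntegral.integral_add_adjacent_intervals h1 h2
    rw [h3, hreint] at this
    linarith
  have hne : ∀ x : ℝ, ∀ᵐ θ : ℝ, θ ≠ x := fun x => by simp [ae_iff]
  have hae : ∀ᵐ θ ∂(volume.restrict (Set.Ioo 0 Real.pi)),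
      (Φ θ).re = angularDensity s σ κ l θ := by
    filter_upwards [ae_restrict_mem measurableSet_Ioo, ae_restrict_of_ae (hne (Real.arccos κ)),
      ae_restrict_of_ae (hne (Real.arccos l)), ae_restrict_of_ae (hne (Real.pi / 2))]
      with θ hθ e1 e2 e3
    rw [hΦ, re_circleProduct hα hβ hθ e1 e2 e3, hcα, hcβ]
  rw [intervalIntegral.integral_of_le hπ.le, integral_Ioc_eq_integral_Ioo,
    integral_congr_ae hae] at h4
  have hInt : Integrable (angularDensity s σ κ l) (volume.restrict (Set.Ioo 0 Real.pi)) := by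
    have := (intervalIntegrable_iff_integrableOn_Ioo_of_le hπ.le).1 h1
    exact Integrable.congr this hae
  rw [← ofReal_integral_eq_lintegral_ofReal hInt, h4]
  filter_upwards [ae_restrict_mem measurableSet_Ioo] with θ hθ
  exact angularDensity_nonneg hs hσ hσ' κ l hθ

/-- Integration in polar coordinates for the Lebesgue integral of a nonnegative function. -/
theorem lintegral_eq_lintegral_toSphere {E : Type*} [NormedAddCommGroup E] [NormedSpace ℝ E]
    [MeasurableSpace E] [BorelSpace E] [FiniteDimensional ℝ E] [Nontrivial E] (μ : Measure E)
    [μ.IsAddHaarMeasure] {f : E → ENNReal} (hf : Measurable f) :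
    ∫⁻ x, f x ∂μ = ∫⁻ ω : Metric.sphere (0 : E) 1, (∫⁻ t in Set.Ioi (0 : ℝ),
      ENNReal.ofReal (t ^ (Module.finrank ℝ E - 1)) * f (t • (ω : E))) ∂μ.toSphere := by
  have h1 : ∫⁻ x, f x ∂μ = ∫⁻ x : ({0}ᶜ : Set E), f x ∂(μ.comap (↑)) := by
    rw [lintegral_subtype_comap (measurableSet_singleton _).compl, restrict_compl_singleton]
  have hg : Measurable fun p : Metric.sphere (0 : E) 1 × Set.Ioi (0 : ℝ) =>
      f ((p.2 : ℝ) • (p.1 : E)) := by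
    fun_prop
  have h2 := (μ.measurePreserving_homeomorphUnitSphereProd).lintegral_comp hg
  rw [h1]
  have h3 : ∀ x : ({0}ᶜ : Set E), f ((((homeomorphUnitSphereProd E) x).2 : ℝ) •
      (((homeomorphUnitSphereProd E) x).1 : E)) = f x := fun x => by
    have hx : ‖(x : E)‖ ≠ 0 := norm_ne_zero_iff.2 x.2
    simp [smul_smul, mul_inv_cancel₀ hx]
  simp only [h3] at h2
  rw [h2, lintegral_prod _ hg.aemeasurable]
  refine lintegral_congr fun ω => ?_
  rw [Measure.volumeIoiPow, lintegral_withDensity_eq_lintegral_mul _ (by fun_prop) (by fun_prop)]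
  exact lintegral_subtype_comap measurableSet_Ioi
    (fun t : ℝ => ENNReal.ofReal (t ^ (Module.finrank ℝ E - 1)) * f (t • (ω : E)))

theorem uSigma_line {N : ℕ} {s σ D c κ l : ℝ} {y : EuclideanSpace ℝ (Fin N)} (hσ : 0 < σ)
    (hD : 0 < D) (hc : c ≠ 0) (hlκ : l < κ)
    (hy : 1 - ‖y‖ ^ 2 = D * ((c - κ) * (c - l)) / c ^ 2) :
    uSigma N s σ y = Real.Gamma ((N : ℝ) / 2) / Real.pi ^ (1 + (N : ℝ) / 2) *
      (D ^ (-σ) * |c| ^ (2 * σ) * |c - κ| ^ (-σ) * |c - l| ^ (-σ) *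
        if l < c ∧ c < κ then Real.sin (Real.pi * (s + σ)) else Real.sin (Real.pi * s)) := by
  have hc2 : 0 < c ^ 2 := by positivity
  have hmod : |1 - ‖y‖ ^ 2| ^ (-σ) =
      D ^ (-σ) * |c| ^ (2 * σ) * |c - κ| ^ (-σ) * |c - l| ^ (-σ) := by
    rw [hy, abs_div, abs_mul, abs_mul, abs_of_pos hD, abs_of_pos hc2,
      Real.div_rpow (by positivity) (by positivity), Real.mul_rpow hD.le (by positivity),
      Real.mul_rpow (abs_nonneg _) (abs_nonneg _), Real.rpow_neg hc2.le, div_inv_eq_mul,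
      ← sq_abs c, ← Real.rpow_natCast, ← Real.rpow_mul (abs_nonneg _)]
    push_cast
    ring
  rw [← hmod]
  have hsign : ∀ P : ℝ, D * P / c ^ 2 = P * (D / c ^ 2) := fun P => by ring
  have hDc : 0 < D / c ^ 2 := by positivity
  rcases lt_trichotomy ‖y‖ 1 with h | h | h
  · have hpos : 0 < 1 - ‖y‖ ^ 2 := by nlinarith [norm_nonneg y]
    have hP : 0 < (c - κ) * (c - l) := by
      rw [hy, hsign] at hpos
      exact pos_of_mul_pos_left hpos hDc.le
    rw [uSigma, if_pos h, if_neg (by rintro ⟨h1, h2⟩; nlinarith), abs_of_pos hpos,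
      Real.rpow_neg hpos.le, cK]
    ring
  · have h0 : 1 - ‖y‖ ^ 2 = 0 := by rw [h]; ring
    rw [uSigma, if_neg (by linarith), if_neg (by linarith), h0, abs_zero,
      Real.zero_rpow (by linarith)]
    ring
  · have hneg : 1 - ‖y‖ ^ 2 < 0 := by nlinarith
    have hP : (c - κ) * (c - l) < 0 := by
      rw [hy, hsign] at hneg
      by_contra! h0
      linarith [mul_nonneg h0 hDc.le]
    have hbetw : l < c ∧ c < κ := by
      rcases mul_neg_iff.1 hP with ⟨h1, h2⟩ | ⟨h1, h2⟩
      · linarith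
      · exact ⟨by linarith, by linarith⟩
    rw [uSigma, if_neg (by linarith), if_pos h, if_pos hbetw, abs_of_neg hneg,
      Real.rpow_neg (by linarith), cK, neg_sub]
    ring

theorem jacobian_mul_eta {N : ℕ} (hN : 1 ≤ N) {s r θ : ℝ} (hr : 0 < r)
    (hθ : θ ∈ Set.Ioo 0 (Real.pi / 2)) {ω : EuclideanSpace ℝ (Fin N)} (hω : ‖ω‖ = 1) :
    r * Real.sin θ / Real.cos θ ^ 2 *
      ((r / Real.cos θ) ^ (N - 1) * eta N s r ((r / Real.cos θ) • ω)) =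
    cK N s * (Real.sin θ ^ (1 - 2 * s) * Real.cos θ ^ (2 * s - 1)) := by
  have hsn : 0 < Real.sin θ := Real.sin_pos_of_pos_of_lt_pi hθ.1 (by linarith [hθ.2, hθ.1])
  have hcs : 0 < Real.cos θ := Real.cos_pos_of_mem_Ioo ⟨by linarith [hθ.1, Real.pi_pos], hθ.2⟩
  have hc1 : Real.cos θ < 1 := by
    nlinarith [Real.sin_sq_add_cos_sq θ, Real.cos_le_one θ]
  have ht : 0 < r / Real.cos θ := by positivity
  have hlt : r < r / Real.cos θ := by
    rw [lt_div_iff₀ hcs]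
    nlinarith
  have hnorm : ‖(r / Real.cos θ) • ω‖ = r / Real.cos θ := by
    rw [norm_smul, hω, mul_one, Real.norm_of_nonneg ht.le]
  have hsq : (r / Real.cos θ) ^ 2 - r ^ 2 = (r * Real.sin θ / Real.cos θ) ^ 2 := by
    field_simp
    linear_combination -(Real.sin_sq_add_cos_sq θ)
  have hpow : ((r * Real.sin θ / Real.cos θ) ^ 2) ^ s =
      r ^ (2 * s) * Real.sin θ ^ (2 * s) / Real.cos θ ^ (2 * s) := by
    rw [← Real.rpow_natCast, ← Real.rpow_mul (by positivity), Real.div_rpow (by positivity) hcs.le,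
      Real.mul_rpow hr.le hsn.le]
    norm_num
  obtain ⟨M, rfl⟩ := Nat.exists_eq_add_of_le' hN
  rw [eta, hnorm, if_pos hlt, hsq, hpow, Real.rpow_sub hsn, Real.rpow_sub hcs, Real.rpow_one,
    Real.rpow_one, Nat.add_sub_cancel, pow_succ (r / Real.cos θ) M]
  have h1 := (Real.rpow_pos_of_pos hr (2 * s)).ne'
  have h2 := (Real.rpow_pos_of_pos hsn (2 * s)).ne'
  have h3 := (Real.rpow_pos_of_pos hcs (2 * s)).ne'
  have h4 := (pow_pos ht M).ne'
  generalize (r / Real.cos θ) ^ M = P at h4 ⊢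
  field_simp

theorem image_div_cos {r : ℝ} (hr : 0 < r) :
    (fun θ => r / Real.cos θ) '' Set.Ioo 0 (Real.pi / 2) = Set.Ioi r := by
  ext t
  constructor
  · rintro ⟨θ, hθ, rfl⟩
    have hcs : 0 < Real.cos θ := Real.cos_pos_of_mem_Ioo ⟨by linarith [hθ.1, Real.pi_pos], hθ.2⟩
    have hc1 : Real.cos θ < 1 := by
      have := Real.strictAntiOn_cos ⟨le_rfl, Real.pi_pos.le⟩
        ⟨hθ.1.le, by linarith [hθ.2, hθ.1]⟩ hθ.1
      rwa [Real.cos_zero] at this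
    rw [Set.mem_Ioi, lt_div_iff₀ hcs]
    nlinarith
  · intro ht
    have ht' : r < t := ht
    have ht0 : 0 < t := hr.trans ht'
    refine ⟨Real.arccos (r / t), ⟨Real.arccos_pos.2 ((div_lt_one ht0).2 ht'),
      Real.arccos_lt_pi_div_two.2 (by positivity)⟩, ?_⟩
    have hle : r / t ≤ 1 := ((div_lt_one ht0).2 ht').le
    have hge : -1 ≤ r / t := by have : 0 ≤ r / t := by positivity
                                linarith
    simp only
    rw [Real.cos_arccos hge hle]
    field_simp

theorem lintegral_Ioi_eq_lintegral_div_cos {r : ℝ} (hr : 0 < r) (g : ℝ → ENNReal) :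
    ∫⁻ t in Set.Ioi r, g t = ∫⁻ θ in Set.Ioo 0 (Real.pi / 2),
      ENNReal.ofReal (r * Real.sin θ / Real.cos θ ^ 2) * g (r / Real.cos θ) := by
  have hcs : ∀ θ ∈ Set.Ioo 0 (Real.pi / 2), 0 < Real.cos θ := fun θ hθ =>
    Real.cos_pos_of_mem_Ioo ⟨by linarith [hθ.1, Real.pi_pos], hθ.2⟩
  rw [← image_div_cos hr, lintegral_image_eq_lintegral_abs_deriv_mul measurableSet_Ioo
    (f' := fun θ => r * Real.sin θ / Real.cos θ ^ 2)]
  · refine setLIntegral_congr_fun measurableSet_Ioo fun θ hθ => ?_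
    have hsn : 0 < Real.sin θ := Real.sin_pos_of_pos_of_lt_pi hθ.1 (by linarith [hθ.2, hθ.1])
    have := hcs θ hθ
    rw [abs_of_nonneg (by positivity)]
  · intro θ hθ
    have := (hasDerivAt_const θ r).div (Real.hasDerivAt_cos θ) (hcs θ hθ).ne'
    refine (this.congr_deriv ?_).hasDerivWithinAt
    ring
  · intro θ hθ φ hφ h
    have h1 := hcs θ hθ
    have h2 := hcs φ hφ
    simp only at h
    rw [div_eq_div_iff h1.ne' h2.ne'] at h
    exact Real.injOn_cos ⟨hθ.1.le, by linarith [hθ.2, hθ.1]⟩ ⟨hφ.1.le, by linarith [hφ.2, hφ.1]⟩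
      (mul_left_cancel₀ hr.ne' h.symm)

theorem measurable_eta (N : ℕ) (s r : ℝ) : Measurable (eta N s r) := by
  unfold eta
  exact Measurable.ite (measurableSet_lt measurable_const measurable_norm) (by fun_prop)
    measurable_const

theorem measurable_uSigma (N : ℕ) (s σ : ℝ) : Measurable (uSigma N s σ) := by
  unfold uSigma
  exact Measurable.ite (measurableSet_lt measurable_norm measurable_const) (by fun_prop)
    (Measurable.ite (measurableSet_lt measurable_const measurable_norm) (by fun_prop)
      measurable_const)

theorem cK_nonneg (N : ℕ) {s : ℝ} (h0 : 0 ≤ s) (h1 : s ≤ 1) : 0 ≤ cK N s := by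
  have hπ := Real.pi_pos
  have h2 : 0 ≤ Real.sin (Real.pi * s) :=
    Real.sin_nonneg_of_nonneg_of_le_pi (by positivity) (by nlinarith)
  have h3 : 0 ≤ Real.Gamma ((N : ℝ) / 2) := Real.Gamma_nonneg_of_nonneg (by positivity)
  unfold cK
  positivity

theorem eta_nonneg (N : ℕ) {s r : ℝ} (hs : s ∈ Set.Ioo (0 : ℝ) 1) (hr : 0 < r)
    (x : EuclideanSpace ℝ (Fin N)) : 0 ≤ eta N s r x := by
  have := cK_nonneg N hs.1.le hs.2.le
  unfold eta
  split_ifs with h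
  · have h2 : 0 ≤ ‖x‖ ^ 2 - r ^ 2 := by nlinarith
    positivity
  · exact le_rfl

theorem uSigma_nonneg (N : ℕ) {s σ : ℝ} (hs : s ∈ Set.Ioo (0 : ℝ) 1) (hσ : 0 < σ)
    (hσ' : σ ≤ 1 - s) (x : EuclideanSpace ℝ (Fin N)) : 0 ≤ uSigma N s σ x := by
  have h1 := cK_nonneg N hs.1.le hs.2.le
  have h2 := cK_nonneg N (by linarith [hs.1] : 0 ≤ s + σ) (by linarith)
  unfold uSigma
  split_ifs with h h'
  · have : 0 ≤ 1 - ‖x‖ ^ 2 := by nlinarith [norm_nonneg x]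
    positivity
  · have : 0 ≤ ‖x‖ ^ 2 - 1 := by nlinarith
    positivity
  · exact le_rfl

theorem angularDensity_pi_sub (s σ κ l θ : ℝ) :
    angularDensity s σ κ l (Real.pi - θ) = angularDensity s σ (-l) (-κ) θ := by
  unfold angularDensity
  rw [Real.sin_pi_sub, Real.cos_pi_sub, abs_neg,
    show -Real.cos θ - κ = -(Real.cos θ - -κ) by ring,
    show -Real.cos θ - l = -(Real.cos θ - -l) by ring, abs_neg, abs_neg]
  have : (l < -Real.cos θ ∧ -Real.cos θ < κ) ↔ (-κ < Real.cos θ ∧ Real.cos θ < -l) := by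
    constructor <;> rintro ⟨h1, h2⟩ <;> constructor <;> linarith
  simp only [this]
  ring

/-- The part of the mean value integral over a ray, after the substitution `t = r / cos θ`. -/
theorem lintegral_ray {N : ℕ} (hN : 1 ≤ N) {s σ r D κ l : ℝ} (hs : s ∈ Set.Ioo (0 : ℝ) 1)
    (hσ : 0 < σ) (hr : 0 < r) (hD : 0 < D) (hlκ : l < κ)
    {x ω : EuclideanSpace ℝ (Fin N)} (hω : ‖ω‖ = 1)
    (hline : ∀ c : ℝ, c ≠ 0 → 1 - ‖x + (r / c) • ω‖ ^ 2 = D * ((c - κ) * (c - l)) / c ^ 2) :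
    ∫⁻ t in Set.Ioi (0 : ℝ), ENNReal.ofReal (t ^ (N - 1)) *
        ENNReal.ofReal (eta N s r (t • ω) * uSigma N s σ (x + t • ω)) =
      ENNReal.ofReal (cK N s * (Real.Gamma ((N : ℝ) / 2) / Real.pi ^ (1 + (N : ℝ) / 2)) *
        D ^ (-σ)) *
        ∫⁻ θ in Set.Ioo 0 (Real.pi / 2), ENNReal.ofReal (angularDensity s σ κ l θ) := by
  have hsupp : ∫⁻ t in Set.Ioi (0 : ℝ), ENNReal.ofReal (t ^ (N - 1)) *
        ENNReal.ofReal (eta N s r (t • ω) * uSigma N s σ (x + t • ω)) =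
      ∫⁻ t in Set.Ioi r, ENNReal.ofReal (t ^ (N - 1)) *
        ENNReal.ofReal (eta N s r (t • ω) * uSigma N s σ (x + t • ω)) := by
    rw [← lintegral_indicator measurableSet_Ioi, ← lintegral_indicator measurableSet_Ioi]
    refine lintegral_congr fun t => ?_
    rcases lt_or_ge r t with ht | ht
    · rw [Set.indicator_of_mem (Set.mem_Ioi.2 (hr.trans ht)),
        Set.indicator_of_mem (Set.mem_Ioi.2 ht)]
    · rw [Set.indicator_of_notMem (s := Set.Ioi r) (not_lt.2 ht)]
      refine Set.indicator_apply_eq_zero.2 fun ht0 => ?_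
      have h1 : ‖t • ω‖ = t := by
        rw [norm_smul, hω, mul_one, Real.norm_of_nonneg (le_of_lt ht0)]
      rw [eta, h1, if_neg (not_lt.2 ht)]
      simp
  have hcK := cK_nonneg N hs.1.le hs.2.le
  have hG : 0 ≤ Real.Gamma ((N : ℝ) / 2) := Real.Gamma_nonneg_of_nonneg (by positivity)
  rw [hsupp, lintegral_Ioi_eq_lintegral_div_cos hr, ← lintegral_const_mul _
    (measurable_angularDensity s σ κ l).ennreal_ofReal]
  refine setLIntegral_congr_fun measurableSet_Ioo fun θ hθ => ?_
  have hsn : 0 < Real.sin θ := Real.sin_pos_of_pos_of_lt_pi hθ.1 (by linarith [hθ.2, hθ.1])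
  have hcs : 0 < Real.cos θ := Real.cos_pos_of_mem_Ioo ⟨by linarith [hθ.1, Real.pi_pos], hθ.2⟩
  rw [← ENNReal.ofReal_mul (by positivity), ← ENNReal.ofReal_mul (by positivity),
    ← ENNReal.ofReal_mul (by positivity)]
  congr 1
  have h1 := jacobian_mul_eta hN (s := s) hr hθ hω
  have h2 := uSigma_line (s := s) hσ hD hcs.ne' hlκ (hline _ hcs.ne')
  rw [h2, angularDensity, show 2 * s + 2 * σ - 1 = (2 * s - 1) + 2 * σ by ring, abs_of_pos hcs,
    Real.rpow_add hcs]
  linear_combination (Real.Gamma ((N : ℝ) / 2) / Real.pi ^ (1 + (N : ℝ) / 2) *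
      (D ^ (-σ) * Real.cos θ ^ (2 * σ) * |Real.cos θ - κ| ^ (-σ) * |Real.cos θ - l| ^ (-σ) *
        if l < Real.cos θ ∧ Real.cos θ < κ then Real.sin (Real.pi * (s + σ))
        else Real.sin (Real.pi * s))) * h1

/-- The part of the mean value integral over a line through the centre does not depend on the
direction of the line. -/
theorem lintegral_line {N : ℕ} (hN : 1 ≤ N) {s σ r : ℝ} (hs : s ∈ Set.Ioo (0 : ℝ) 1)
    (hσ : 0 < σ) (hσ' : σ ≤ 1 - s) (hr : 0 < r) {x ω : EuclideanSpace ℝ (Fin N)}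
    (hx : r < 1 - ‖x‖) (hω : ‖ω‖ = 1) :
    (∫⁻ t in Set.Ioi (0 : ℝ), ENNReal.ofReal (t ^ (N - 1)) *
        ENNReal.ofReal (eta N s r (t • ω) * uSigma N s σ (x + t • ω))) +
      (∫⁻ t in Set.Ioi (0 : ℝ), ENNReal.ofReal (t ^ (N - 1)) *
        ENNReal.ofReal (eta N s r (t • -ω) * uSigma N s σ (x + t • -ω))) =
      ENNReal.ofReal (cK N s * (Real.Gamma ((N : ℝ) / 2) / Real.pi ^ (1 + (N : ℝ) / 2)) *
        (1 - ‖x‖ ^ 2) ^ (-σ) * Real.pi) := by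
  set b : ℝ := inner ℝ x ω with hb
  set D : ℝ := 1 - ‖x‖ ^ 2 with hD
  have hx0 := norm_nonneg x
  have hDpos : 0 < D := by nlinarith
  have hbx : |b| ≤ ‖x‖ := by
    have := abs_real_inner_le_norm x ω
    rwa [hω, mul_one] at this
  have hbx' := abs_le.1 hbx
  set R : ℝ := Real.sqrt (b ^ 2 + D) with hR
  have hRsq : R ^ 2 = b ^ 2 + D := Real.sq_sqrt (by positivity)
  have hR0 : 0 ≤ R := Real.sqrt_nonneg _
  have hR1 : R ≤ 1 := by
    have : b ^ 2 ≤ ‖x‖ ^ 2 := by nlinarith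
    nlinarith
  have hbR : |b| < R := abs_lt_of_sq_lt_sq (by nlinarith) hR0
  have hbR' := abs_lt.1 hbR
  set κ : ℝ := r * (b + R) / D with hκ
  set l : ℝ := r * (b - R) / D with hl
  have hκ1 : κ ∈ Set.Ioo (0 : ℝ) 1 := by
    constructor
    · have : 0 < b + R := by linarith
      positivity
    · rw [hκ, div_lt_one hDpos]
      nlinarith
  have hl1 : l ∈ Set.Ioo (-1 : ℝ) 0 := by
    constructor
    · rw [hl, lt_div_iff₀ hDpos]
      nlinarith
    · have : b - R < 0 := by linarith
      exact div_neg_of_neg_of_pos (mul_neg_of_pos_of_neg hr this) hDpos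
  have hline : ∀ c : ℝ, c ≠ 0 →
      1 - ‖x + (r / c) • ω‖ ^ 2 = D * ((c - κ) * (c - l)) / c ^ 2 := by
    intro c hc
    rw [norm_add_sq_real, real_inner_smul_right, norm_smul, hω, ← hb, mul_one, Real.norm_eq_abs,
      sq_abs, hκ, hl]
    field_simp
    linear_combination (r ^ 2) * hRsq + (c ^ 2 * D) * hD
  have hline' : ∀ c : ℝ, c ≠ 0 →
      1 - ‖x + (r / c) • -ω‖ ^ 2 = D * ((c - -l) * (c - -κ)) / c ^ 2 := by
    intro c hc
    have := hline (-c) (neg_ne_zero.2 hc)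
    rw [div_neg, neg_smul, ← smul_neg] at this
    rw [this]
    ring
  rw [lintegral_ray hN hs hσ hr hDpos (by linarith [hκ1.1, hl1.2]) hω hline,
    lintegral_ray hN hs hσ hr hDpos (by linarith [hκ1.1, hl1.2]) (by rwa [norm_neg]) hline',
    ← mul_add]
  have hrefl : ∫⁻ θ in Set.Ioo 0 (Real.pi / 2),
      ENNReal.ofReal (angularDensity s σ (-l) (-κ) θ) =
      ∫⁻ θ in Set.Ioo (Real.pi / 2) Real.pi, ENNReal.ofReal (angularDensity s σ κ l θ) := by
    have := (Measure.measurePreserving_sub_left volume Real.pi).setLIntegral_comp_preimage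
      (s := Set.Ioo (Real.pi / 2) Real.pi) measurableSet_Ioo
      (measurable_angularDensity s σ κ l).ennreal_ofReal
    rw [← this, Set.preimage_const_sub_Ioo]
    simp only [angularDensity_pi_sub]
    rw [sub_self, sub_half]
  have hsplit : (∫⁻ θ in Set.Ioo 0 (Real.pi / 2), ENNReal.ofReal (angularDensity s σ κ l θ)) +
      ∫⁻ θ in Set.Ioo (Real.pi / 2) Real.pi, ENNReal.ofReal (angularDensity s σ κ l θ) =
      ENNReal.ofReal Real.pi := by
    have hdisj : Disjoint (Set.Ioo 0 (Real.pi / 2)) (Set.Ico (Real.pi / 2) Real.pi) :=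
      Set.disjoint_left.2 fun θ h1 h2 => absurd h1.2 (not_lt.2 h2.1)
    rw [← lintegral_angularDensity hs hσ hσ' hκ1 hl1, ← Set.Ioo_union_Ico_eq_Ioo
      (by linarith [Real.pi_pos] : 0 < Real.pi / 2) (by linarith [Real.pi_pos] :
        Real.pi / 2 ≤ Real.pi),
      lintegral_union measurableSet_Ico hdisj,
      setLIntegral_congr (s := Set.Ioo (Real.pi / 2) Real.pi) Ioo_ae_eq_Ico]
  have hcK := cK_nonneg N hs.1.le hs.2.le
  have hG : 0 ≤ Real.Gamma ((N : ℝ) / 2) := Real.Gamma_nonneg_of_nonneg (by positivity)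
  have hπ := Real.pi_pos
  rw [hrefl, hsplit, ← ENNReal.ofReal_mul (by positivity)]

/-- The nonlocal mean value property of `uSigma`, as a Lebesgue integral. -/
theorem lintegral_eta_mul_uSigma {N : ℕ} (hN : 2 ≤ N) {s σ r : ℝ} (hs : s ∈ Set.Ioo (0 : ℝ) 1)
    (hσ : 0 < σ) (hσ' : σ ≤ 1 - s) (hr : 0 < r) {x : EuclideanSpace ℝ (Fin N)}
    (hx : r < 1 - ‖x‖) :
    ∫⁻ z, ENNReal.ofReal (eta N s r z * uSigma N s σ (x + z)) =
      ENNReal.ofReal (uSigma N s σ x) := by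
  have : NeZero N := ⟨by omega⟩
  have : Nontrivial (EuclideanSpace ℝ (Fin N)) :=
    Module.nontrivial_of_finrank_pos (R := ℝ) (by rw [finrank_euclideanSpace_fin]; omega)
  set F : EuclideanSpace ℝ (Fin N) → ENNReal :=
    fun z => ENNReal.ofReal (eta N s r z * uSigma N s σ (x + z)) with hF
  have hFm : Measurable F := ((measurable_eta N s r).mul
    ((measurable_uSigma N s σ).comp (measurable_const_add x))).ennreal_ofReal
  set A : ℝ := Real.Gamma ((N : ℝ) / 2) / Real.pi ^ (1 + (N : ℝ) / 2) with hA
  have hcK := cK_nonneg N hs.1.le hs.2.le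
  have hN0 : (0 : ℝ) < N := by exact_mod_cast (by omega : 0 < N)
  have hG : 0 < Real.Gamma ((N : ℝ) / 2) := Real.Gamma_pos_of_pos (by positivity)
  have hπ := Real.pi_pos
  have hx1 : ‖x‖ < 1 := by linarith
  have hD : 0 < 1 - ‖x‖ ^ 2 := by nlinarith [norm_nonneg x]
  have hsphere : (volume : Measure (EuclideanSpace ℝ (Fin N))).toSphere Set.univ =
      ENNReal.ofReal (2 / (A * Real.pi)) := by
    rw [Measure.toSphere_apply_univ, EuclideanSpace.volume_ball, finrank_euclideanSpace_fin,
      Fintype.card_fin, ENNReal.ofReal_one, one_pow, one_mul, ← ENNReal.ofReal_natCast,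
      ← ENNReal.ofReal_mul hN0.le, Real.Gamma_add_one (by positivity), Real.sqrt_eq_rpow,
      ← Real.rpow_natCast, ← Real.rpow_mul hπ.le, hA, Real.rpow_add hπ, Real.rpow_one]
    congr 1
    rw [show (1 / 2 : ℝ) * N = N / 2 by ring]
    have : 0 < Real.pi ^ ((N : ℝ) / 2) := by positivity
    field_simp
  have hdouble : 2 * ∫⁻ z, F z = 2 * ENNReal.ofReal (uSigma N s σ x) := by
    calc 2 * ∫⁻ z, F z = ∫⁻ z, (F z + F (-z)) := by
          rw [lintegral_add_left hFm, lintegral_neg_eq_self, two_mul]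
      _ = ∫⁻ _ : Metric.sphere (0 : EuclideanSpace ℝ (Fin N)) 1,
            ENNReal.ofReal (cK N s * A * (1 - ‖x‖ ^ 2) ^ (-σ) * Real.pi)
            ∂(volume : Measure (EuclideanSpace ℝ (Fin N))).toSphere := by
          rw [lintegral_eq_lintegral_toSphere volume
            (by fun_prop : Measurable fun z => F z + F (-z))]
          refine lintegral_congr fun ω => ?_
          rw [← lintegral_line (by omega) hs hσ hσ' hr hx (norm_eq_of_mem_sphere ω),
            finrank_euclideanSpace_fin, ← lintegral_add_left]
          · refine lintegral_congr fun t => ?_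
            simp only [hF, mul_add, smul_neg]
          · exact (by fun_prop : Measurable fun t : ℝ => ENNReal.ofReal (t ^ (N - 1))).mul
              (hFm.comp (measurable_id.smul_const (ω : EuclideanSpace ℝ (Fin N))))
      _ = 2 * ENNReal.ofReal (uSigma N s σ x) := by
          rw [lintegral_const, hsphere, ← ENNReal.ofReal_mul (by positivity),
            show (2 : ENNReal) * ENNReal.ofReal (uSigma N s σ x) =
              ENNReal.ofReal (2 * uSigma N s σ x) by
                rw [ENNReal.ofReal_mul (by norm_num), ENNReal.ofReal_ofNat], uSigma, if_pos hx1,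
            Real.rpow_neg hD.le]
          congr 1
          have : 0 < A := by positivity
          have : 0 < (1 - ‖x‖ ^ 2) ^ σ := by positivity
          field_simp
  exact (ENNReal.mul_right_inj (by norm_num) (by norm_num)).1 hdouble

theorem lt_one_sub_norm_of_lt_infEDist {N : ℕ} (hN : 1 ≤ N) {x : EuclideanSpace ℝ (Fin N)}
    (hx : ‖x‖ < 1) {r : ℝ}
    (h : ENNReal.ofReal r < Metric.infEDist x (Metric.ball 0 1)ᶜ) : r < 1 - ‖x‖ := by
  have : NeZero N := ⟨by omega⟩
  have : Nontrivial (EuclideanSpace ℝ (Fin N)) :=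
    Module.nontrivial_of_finrank_pos (R := ℝ) (by rw [finrank_euclideanSpace_fin]; omega)
  obtain ⟨w, hw, hxw⟩ : ∃ w : EuclideanSpace ℝ (Fin N), ‖w‖ = 1 ∧ x = ‖x‖ • w := by
    rcases eq_or_ne x 0 with rfl | h0
    · obtain ⟨w, hw⟩ := exists_norm_eq (EuclideanSpace ℝ (Fin N)) zero_le_one
      exact ⟨w, hw, by simp⟩
    · have h1 : ‖x‖ ≠ 0 := norm_ne_zero_iff.2 h0
      refine ⟨‖x‖⁻¹ • x, ?_, ?_⟩
      · rw [norm_smul, norm_inv, norm_norm, inv_mul_cancel₀ h1]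
      · rw [smul_smul, mul_inv_cancel₀ h1, one_smul]
  have hmem : w ∈ (Metric.ball (0 : EuclideanSpace ℝ (Fin N)) 1)ᶜ := by simp [hw]
  have hdist : dist x w = 1 - ‖x‖ := by
    have h1 : x - w = -((1 - ‖x‖) • w) := by
      rw [sub_smul, one_smul, ← hxw]
      abel
    rw [dist_eq_norm, h1, norm_neg, norm_smul, hw, mul_one, Real.norm_of_nonneg (by linarith)]
  have h2 := h.trans_le (Metric.infEDist_le_edist_of_mem hmem)
  rw [edist_dist, hdist] at h2
  exact lt_of_not_ge fun h3 => h2.not_ge (ENNReal.ofReal_le_ofReal h3)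

theorem isSHarmonic_uSigma {N : ℕ} (hN : 2 ≤ N) {s σ : ℝ} (hs : s ∈ Set.Ioo (0 : ℝ) 1)
    (hσ : 0 < σ) (hσ' : σ ≤ 1 - s) : IsSHarmonic N s (Metric.ball 0 1) (uSigma N s σ) := by
  refine ⟨?_, fun x hx r hr hdist => ?_⟩
  · have hpos : ∀ x ∈ Metric.ball (0 : EuclideanSpace ℝ (Fin N)) 1, 0 < 1 - ‖x‖ ^ 2 :=
      fun x hx => by
        rw [mem_ball_zero_iff] at hx
        nlinarith [norm_nonneg x]
    have hcont : ContinuousOn (fun x : EuclideanSpace ℝ (Fin N) => cK N s / (1 - ‖x‖ ^ 2) ^ σ)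
        (Metric.ball 0 1) :=
      continuousOn_const.div ((by fun_prop : Continuous fun x : EuclideanSpace ℝ (Fin N) =>
        1 - ‖x‖ ^ 2).continuousOn.rpow_const fun x hx => Or.inl (hpos x hx).ne')
        fun x hx => (Real.rpow_pos_of_pos (hpos x hx) σ).ne'
    exact hcont.congr fun x hx => if_pos (mem_ball_zero_iff.1 hx)
  · rw [mem_ball_zero_iff] at hx
    have hrx := lt_one_sub_norm_of_lt_infEDist (by omega) hx hdist
    have hnonneg : ∀ y, 0 ≤ eta N s r (y - x) * uSigma N s σ y := fun y =>
      mul_nonneg (eta_nonneg N hs hr _) (uSigma_nonneg N hs hσ hσ' y)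
    have hmeas : Measurable fun y => eta N s r (y - x) * uSigma N s σ y :=
      ((measurable_eta N s r).comp (measurable_sub_const x)).mul (measurable_uSigma N s σ)
    have hlint : ∫⁻ y, ENNReal.ofReal (eta N s r (y - x) * uSigma N s σ y) =
        ENNReal.ofReal (uSigma N s σ x) := by
      rw [← lintegral_eta_mul_uSigma hN hs hσ hσ' hr hrx, ← lintegral_add_left_eq_self _ x]
      simp only [add_sub_cancel_left]
    have hint : Integrable fun y => eta N s r (y - x) * uSigma N s σ y :=
      ⟨hmeas.aestronglyMeasurable, (hasFiniteIntegral_iff_ofReal (ae_of_all _ hnonneg)).2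
        (hlint ▸ ENNReal.ofReal_lt_top)⟩
    refine ⟨hint.integrableOn, ?_⟩
    rw [setIntegral_eq_integral_of_forall_compl_eq_zero fun y hy => ?_,
      integral_eq_lintegral_of_nonneg_ae (ae_of_all _ hnonneg) hmeas.aestronglyMeasurable, hlint,
      ENNReal.toReal_ofReal (uSigma_nonneg N hs hσ hσ' x)]
    rw [Set.notMem_compl_iff, mem_ball_iff_norm] at hy
    rw [eta, if_neg hy.not_gt, zero_mul]

theorem uLim_eq_uSigma (N : ℕ) (s : ℝ) : uLim N s = uSigma N s (1 - s) := by
  have hcK : cK N (s + (1 - s)) = 0 := by simp [cK]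
  ext x
  simp only [uLim, uSigma, hcK, zero_div, ite_self]

/-- **Explicit large `s`-harmonic functions on the unit ball**: for `0 < σ < 1−s` the function
`u_σ` is `s`-harmonic in the unit ball, and so is the function `u_{1−s}`. -/
theorem sharmonic_examples_ball (N : ℕ) (hN : 2 ≤ N) (s : ℝ) (hs : s ∈ Set.Ioo (0 : ℝ) 1)
    (σ : ℝ) (hσ : 0 < σ) (hσ' : σ < 1 - s) :
    IsSHarmonic N s (Metric.ball 0 1) (uSigma N s σ) ∧
    IsSHarmonic N s (Metric.ball 0 1) (uLim N s) := by
  refine ⟨isSHarmonic_uSigma hN hs hσ hσ'.le, ?_⟩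
  rw [uLim_eq_uSigma]
  exact isSHarmonic_uSigma hN hs (by linarith [hs.2]) le_rfl
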